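/- arXiv:2510.09449 — 3 statements merged into one kernel-verified Lean document; each statement's English description precedes it below -/
import Mathlib

section
/- Let b > 0, s > 0, and M, L ≥ 0. Let e : (0,s) × (0,1) → ℝ be measurable and satisfy |e(t,x)| ≤ M for almost every (t,x), and |e(t,x)| ≤ L·x for almost every (t,x) with t > x/b. Then lim_{δ → 0⁺} (1/δ) ∫₀^s ∫₀^δ (b/2) e(t,x)² dx dt = 0. -/
open MeasureTheory Set Filter

/-- If `f` is nonnegative and bounded above a.e. by a constant, so is its integral over `(0, δ)`
by the constant times `δ`. -/
lemma intervalIntegral_le_mul_of_ae_le {f : ℝ → ℝ} {δ C : ℝ} (hδ : 0 ≤ δ) (hf : ∀ x, 0 ≤ f x)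
    (hC : ∀ᵐ x ∂(volume.restrict (Ioc 0 δ)), f x ≤ C) : ∫ x in (0 : ℝ)..δ, f x ≤ δ * C := by
  rw [intervalIntegral.integral_of_le hδ]
  calc ∫ x in Ioc 0 δ, f x ≤ ∫ _ in Ioc 0 δ, C :=
        integral_mono_of_nonneg (ae_of_all _ hf) (integrable_const _) hC
    _ = δ * C := by simp [hδ]

/-- The integral over `(0, s)` of a nonnegative function that is a.e. at most `A`, plus `B` on
`t ≤ a`. -/
lemma intervalIntegral_le_of_ae_le_add_indicator {f : ℝ → ℝ} {s a A B : ℝ} (hs : 0 ≤ s)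
    (ha : 0 ≤ a) (hB : 0 ≤ B) (hf : ∀ t, 0 ≤ f t)
    (hle : ∀ᵐ t ∂(volume.restrict (Ioc 0 s)), f t ≤ A + (Iic a).indicator (fun _ => B) t) :
    ∫ t in (0 : ℝ)..s, f t ≤ s * A + a * B := by
  have hint : Integrable ((Iic a).indicator fun _ : ℝ => B) (volume.restrict (Ioc 0 s)) :=
    (integrable_const B).indicator measurableSet_Iic
  have hvol : volume.real (Iic a ∩ Ioc 0 s) ≤ a := by
    calc volume.real (Iic a ∩ Ioc 0 s) ≤ volume.real (Ioc 0 a) :=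
          measureReal_mono (fun _ ht => ⟨ht.2.1, ht.1⟩) (by simp)
      _ = a := by simp [ha]
  rw [intervalIntegral.integral_of_le hs]
  calc ∫ t in Ioc 0 s, f t ≤ ∫ t in Ioc 0 s, (A + (Iic a).indicator (fun _ => B) t) :=
        integral_mono_of_nonneg (ae_of_all _ hf) ((integrable_const A).add hint) hle
    _ = s * A + volume.real (Iic a ∩ Ioc 0 s) * B := by
        rw [integral_add (integrable_const A) hint, integral_indicator measurableSet_Iic,
          Measure.restrict_restrict measurableSet_Iic]
        simp [hs]
    _ ≤ s * A + a * B := by gcongr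

/-- **Inflow boundary-layer estimate for the inviscid linear advection analysis:**
if `e` is measurable on `(0,s) × (0,1)` with `|e| ≤ M` a.e. and `|e(t,x)| ≤ L x`
a.e. on the characteristic region `{t > x/b}`, then
`(1/δ) ∫₀ˢ ∫₀^δ (b/2) e² dx dt → 0` as `δ → 0⁺`. -/
theorem inflow_boundary_layer_vanishes
    (b s M L : ℝ) (hb : 0 < b) (hs : 0 < s) (hM : 0 ≤ M) (hL : 0 ≤ L)
    (e : ℝ → ℝ → ℝ) (he : Measurable (Function.uncurry e))
    (hbd : ∀ᵐ p ∂(volume.restrict (Ioo 0 s ×ˢ Ioo (0 : ℝ) 1) : Measure (ℝ × ℝ)),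
      |e p.1 p.2| ≤ M)
    (hlip : ∀ᵐ p ∂(volume.restrict (Ioo 0 s ×ˢ Ioo (0 : ℝ) 1) : Measure (ℝ × ℝ)),
      p.2 / b < p.1 → |e p.1 p.2| ≤ L * p.2) :
    Tendsto (fun δ : ℝ => (1 / δ) * ∫ t in (0 : ℝ)..s, ∫ x in (0 : ℝ)..δ, (b / 2) * (e t x) ^ 2)
      (nhdsWithin 0 (Ioi 0)) (nhds 0) := by
  have hlim : Tendsto (fun δ : ℝ => s * (b / 2 * (L ^ 2 * δ ^ 2)) + δ / b * (b / 2 * M ^ 2))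
      (nhdsWithin 0 (Ioi 0)) (nhds 0) := by
    have hcont : Continuous fun δ : ℝ =>
        s * (b / 2 * (L ^ 2 * δ ^ 2)) + δ / b * (b / 2 * M ^ 2) := by fun_prop
    simpa using (hcont.tendsto 0).mono_left nhdsWithin_le_nhds
  have hinner_nonneg (δ : ℝ) (hδ : 0 < δ) (t : ℝ) :
      0 ≤ ∫ x in (0 : ℝ)..δ, b / 2 * e t x ^ 2 :=
    intervalIntegral.integral_nonneg hδ.le fun x _ => by positivity
  have hsq : ∀ᵐ t ∂(volume.restrict (Ioc 0 s)), ∀ᵐ x ∂(volume.restrict (Ioo (0 : ℝ) 1)),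
      |e t x| ≤ M ∧ (x / b < t → |e t x| ≤ L * x) := by
    have h := hbd.and hlip
    rw [Measure.volume_eq_prod, ← Measure.prod_restrict] at h
    rw [← restrict_Ioo_eq_restrict_Ioc]
    exact Measure.ae_ae_of_ae_prod h
  refine tendsto_of_tendsto_of_tendsto_of_le_of_le' tendsto_const_nhds hlim ?_ ?_
  · filter_upwards [self_mem_nhdsWithin] with δ (hδ : 0 < δ)
    exact mul_nonneg (by positivity)
      (intervalIntegral.integral_nonneg hs.le fun t _ => hinner_nonneg δ hδ t)
  · filter_upwards [Ioo_mem_nhdsGT (zero_lt_one' ℝ)] with δ hδ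
    have hδ0 : 0 < δ := hδ.1
    have hbound := intervalIntegral_le_of_ae_le_add_indicator
      (f := fun t => ∫ x in (0 : ℝ)..δ, b / 2 * e t x ^ 2) (a := δ / b)
      (A := δ * (b / 2 * (L ^ 2 * δ ^ 2))) (B := δ * (b / 2 * M ^ 2)) hs.le (by positivity)
      (by positivity) (hinner_nonneg δ hδ0) ?_
    · calc _ ≤ 1 / δ * (s * (δ * (b / 2 * (L ^ 2 * δ ^ 2))) + δ / b * (δ * (b / 2 * M ^ 2))) := by
            gcongr
        _ = _ := by field_simp
    · filter_upwards [hsq] with t ht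
      have ht' : ∀ᵐ x ∂(volume.restrict (Ioc 0 δ)),
          |e t x| ≤ M ∧ (x / b < t → |e t x| ≤ L * x) :=
        ae_restrict_of_ae_restrict_of_subset (Ioc_subset_Ioo_right hδ.2) ht
      by_cases hta : t ≤ δ / b
      · rw [indicator_of_mem (mem_Iic.2 hta)]
        refine (intervalIntegral_le_mul_of_ae_le (C := b / 2 * M ^ 2) hδ0.le
          (fun x => by positivity) ?_).trans (le_add_of_nonneg_left (by positivity))
        filter_upwards [ht'] with x hx
        have := sq_le_sq' (neg_le_of_abs_le hx.1) (le_of_abs_le hx.1)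
        gcongr
      · rw [indicator_of_notMem (by simpa using hta), add_zero]
        refine intervalIntegral_le_mul_of_ae_le hδ0.le (fun x => by positivity) ?_
        filter_upwards [ht', ae_restrict_mem measurableSet_Ioc] with x hx hxδ
        have hxt : x / b < t := lt_of_le_of_lt (by gcongr; exact hxδ.2) (not_le.1 hta)
        have hLδ : |e t x| ≤ L * δ := (hx.2 hxt).trans (by gcongr; exact hxδ.2)
        have := sq_le_sq' (neg_le_of_abs_le hLδ) (le_of_abs_le hLδ)
        rw [← mul_pow]
        gcongr
end

section
/- Let U ⊂ ℝ^m be open, let η : ℝ^m → ℝ and f : ℝ^m → ℝ^m be twice continuously differentiable on U, and let q : ℝ^m → ℝ be differentiable on U with Dq(x) = Dη(x) ∘ Df(x) (as linear maps ℝ^m → ℝ) for every x ∈ U. Then for every x ∈ U and all vectors v, w ∈ ℝ^m: D²η(x)(Df(x)v, w) = D²η(x)(Df(x)w, v), where D²η(x) denotes the second derivative of η at x viewed as a bilinear form on ℝ^m. Equivalently, in matrix form, (Df(x))ᵀ D²η(x) = D²η(x) Df(x); i.e., the existence of an entropy flux q for the entropy η forces the Hessian of η to commute with Df in this sense. -/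
/-- **Existence of an entropy flux forces the commutation `(Df)ᵀ D²η = D²η Df`.**
If `η, f` are `C²` on an open set `U ⊆ ℝ^m` and `q` satisfies `Dq = Dη ∘ Df` on `U`,
then the Hessian of `η` satisfies `D²η(x)(Df(x)v, w) = D²η(x)(Df(x)w, v)` on `U`. -/
theorem entropy_flux_hessian_commutes
    (m : ℕ) (hm : 1 ≤ m)
    (U : Set (EuclideanSpace ℝ (Fin m))) (hU : IsOpen U)
    (η : EuclideanSpace ℝ (Fin m) → ℝ)
    (f : EuclideanSpace ℝ (Fin m) → EuclideanSpace ℝ (Fin m))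
    (hη : ContDiffOn ℝ 2 η U) (hf : ContDiffOn ℝ 2 f U)
    (q : EuclideanSpace ℝ (Fin m) → ℝ)
    (hq : ∀ x ∈ U, HasFDerivAt q ((fderiv ℝ η x).comp (fderiv ℝ f x)) x) :
    ∀ x ∈ U, ∀ v w : EuclideanSpace ℝ (Fin m),
      fderiv ℝ (fderiv ℝ η) x (fderiv ℝ f x v) w
        = fderiv ℝ (fderiv ℝ η) x (fderiv ℝ f x w) v := by
  intro x hx v w
  have hUx := hU.mem_nhds hx
  have hηx : ContDiffAt ℝ 2 η x := hη.contDiffAt hUx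
  have hfx : ContDiffAt ℝ 2 f x := hf.contDiffAt hUx
  have hDη : HasFDerivAt (fderiv ℝ η) (fderiv ℝ (fderiv ℝ η) x) x :=
    ((hηx.fderiv_right (m := 1) (by norm_num)).differentiableAt (by norm_num)).hasFDerivAt
  have hDf : HasFDerivAt (fderiv ℝ f) (fderiv ℝ (fderiv ℝ f) x) x :=
    ((hfx.fderiv_right (m := 1) (by norm_num)).differentiableAt (by norm_num)).hasFDerivAt
  have hηsymm : IsSymmSndFDerivAt ℝ η x := hηx.isSymmSndFDerivAt (by simp)
  have hfsymm : IsSymmSndFDerivAt ℝ f x := hfx.isSymmSndFDerivAt (by simp)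
  have hqsymm := second_derivative_symmetric_of_eventually
    (Filter.eventually_of_mem hUx hq) (hDη.clm_comp hDf) v w
  simp only [add_apply, ContinuousLinearMap.comp_apply,
    ContinuousLinearMap.compL_apply, ContinuousLinearMap.flip_apply, hfsymm.eq v w] at hqsymm
  rw [hηsymm.eq _ w, hηsymm.eq _ v]
  exact (add_left_cancel hqsymm).symm
end

section
/- Let q ≥ 1 be an integer, let x₀ < x₁ be real numbers, let w be a real polynomial of degree at most q, and let α, β ∈ ℝ. Then there exists a unique real polynomial p of degree at most q + 1 such that: (i) ∫_{x₀}^{x₁} (p(x) − w(x)) ψ(x) dx = 0 for every real polynomial ψ of degree at most q − 1, and (ii) p(x₀) = α and p(x₁) = β. -/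
open MeasureTheory

namespace Polynomial

theorem degree_le_iff_mem_degreeLT_add_one {R : Type*} [Semiring R] {n : ℕ} {p : R[X]} :
    p.degree ≤ (n : WithBot ℕ) ↔ p ∈ degreeLT R (n + 1) := by
  rw [mem_degreeLT]
  induction p.degree with
  | bot => simp
  | coe d => exact WithBot.coe_le_coe.trans (Nat.lt_succ_iff.symm.trans WithBot.coe_lt_coe.symm)

/-- The `L²` pairing of polynomials on the interval from `a` to `b`. -/
noncomputable def intervalPairing (a b : ℝ) : ℝ[X] →ₗ[ℝ] ℝ[X] →ₗ[ℝ] ℝ :=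
  LinearMap.mk₂ ℝ (fun p ψ => ∫ x in a..b, p.eval x * ψ.eval x)
    (fun p p' ψ => by
      simp only [eval_add, add_mul]
      exact intervalIntegral.integral_add
        ((p.continuous.mul ψ.continuous).intervalIntegrable _ _)
        ((p'.continuous.mul ψ.continuous).intervalIntegrable _ _))
    (fun c p ψ => by
      simp only [eval_smul, smul_eq_mul, mul_assoc, intervalIntegral.integral_const_mul])
    (fun p ψ ψ' => by
      simp only [eval_add, mul_add]
      exact intervalIntegral.integral_add
        ((p.continuous.mul ψ.continuous).intervalIntegrable _ _)
        ((p.continuous.mul ψ'.continuous).intervalIntegrable _ _))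
    (fun c p ψ => by
      simp only [eval_smul, smul_eq_mul, mul_left_comm _ c,
        intervalIntegral.integral_const_mul])

theorem intervalPairing_apply (a b : ℝ) (p ψ : ℝ[X]) :
    intervalPairing a b p ψ = ∫ x in a..b, p.eval x * ψ.eval x := rfl

theorem intervalPairing_bubble_mul_self_ne_zero {a b : ℝ} (hab : a < b) {r : ℝ[X]}
    (hr : r ≠ 0) : intervalPairing a b ((X - C a) * (X - C b) * r) r ≠ 0 := by
  obtain ⟨c, hc, hrc⟩ : ∃ c ∈ Set.Ioo a b, c ∉ {x | r.IsRoot x} :=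
    ((Set.Ioo_infinite hab).sdiff (finite_setOfPred_isRoot hr)).nonempty
  have hpos : 0 < ∫ x in a..b, (x - a) * (b - x) * r.eval x ^ 2 := by
    refine intervalIntegral.integral_pos hab (by fun_prop) (fun x hx => ?_)
      ⟨c, Set.Ioo_subset_Icc_self hc, ?_⟩
    · exact mul_nonneg (mul_nonneg (by linarith [hx.1]) (by linarith [hx.2])) (sq_nonneg _)
    · exact mul_pos (mul_pos (by linarith [hc.1]) (by linarith [hc.2])) (sq_pos_of_ne_zero hrc)
  have hneg : intervalPairing a b ((X - C a) * (X - C b) * r) r =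
      -∫ x in a..b, (x - a) * (b - x) * r.eval x ^ 2 := by
    rw [intervalPairing_apply, ← intervalIntegral.integral_neg]
    congr 1 with x
    simp only [eval_mul, eval_sub, eval_X, eval_C]
    ring
  rw [hneg]
  exact neg_ne_zero.mpr hpos.ne'

theorem exists_eq_mul_of_eval_eq_zero {K : Type*} [Field K] {a b : K} (hab : a ≠ b) {p : K[X]}
    (ha : p.eval a = 0) (hb : p.eval b = 0) : ∃ r, p = (X - C a) * (X - C b) * r :=
  (isCoprime_X_sub_C_of_isUnit_sub (sub_ne_zero.mpr hab).isUnit).mul_dvd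
    (dvd_iff_isRoot.mpr ha) (dvd_iff_isRoot.mpr hb)

/-- Moments against polynomials of degree less than `n`, together with the two endpoint values. -/
noncomputable def momentEndpointMap (a b : ℝ) (n : ℕ) :
    degreeLT ℝ (n + 2) →ₗ[ℝ] Module.Dual ℝ (degreeLT ℝ n) × ℝ × ℝ :=
  (((degreeLT ℝ n).subtype.dualMap ∘ₗ intervalPairing a b).prod
    ((leval a).prod (leval b))) ∘ₗ (degreeLT ℝ (n + 2)).subtype

theorem momentEndpointMap_injective {a b : ℝ} (hab : a < b) (n : ℕ) :
    Function.Injective (momentEndpointMap a b n) := by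
  rw [injective_iff_map_eq_zero]
  rintro ⟨p, hp⟩ h
  have hm := congrArg Prod.fst h
  have ha : p.eval a = 0 := congrArg (fun v => v.2.1) h
  have hb : p.eval b = 0 := congrArg (fun v => v.2.2) h
  obtain ⟨r, rfl⟩ := exists_eq_mul_of_eval_eq_zero hab.ne ha hb
  by_cases hr : r = 0
  · simp [hr]
  have hrn : r ∈ degreeLT ℝ n := by
    rw [mem_degreeLT] at hp ⊢
    rw [degree_mul, degree_mul, degree_X_sub_C, degree_X_sub_C, degree_eq_natDegree hr] at hp
    rw [degree_eq_natDegree hr]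
    norm_cast at hp ⊢
    lia
  exact absurd (LinearMap.congr_fun hm ⟨r, hrn⟩) (intervalPairing_bubble_mul_self_ne_zero hab hr)

theorem momentEndpointMap_bijective {a b : ℝ} (hab : a < b) (n : ℕ) :
    Function.Bijective (momentEndpointMap a b n) := by
  have (k : ℕ) : Module.Finite ℝ (degreeLT ℝ k) := Module.Finite.equiv (degreeLTEquiv ℝ k).symm
  have hfin (k : ℕ) : Module.finrank ℝ (degreeLT ℝ k) = k := by
    simpa using (degreeLTEquiv ℝ k).finrank_eq
  have hinj := momentEndpointMap_injective hab n
  refine ⟨hinj, (LinearMap.injective_iff_surjective_of_finrank_eq_finrank ?_).mp hinj⟩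
  rw [Module.finrank_prod, Module.finrank_prod, Subspace.dual_finrank_eq, hfin, hfin,
    Module.finrank_self]

end Polynomial

/-- **Unique solvability of the single-cell spatial reconstruction problem:**
given `q ≥ 1`, a cell `(x₀, x₁)`, a polynomial `w` of degree at most `q` and endpoint
values `α, β`, there is a unique polynomial `p` of degree at most `q + 1` that is
`L²`-orthogonal to all polynomials of degree at most `q − 1` after subtracting `w`,
and matches the endpoint values. -/
theorem spatial_reconstruction_existsUnique
    (q : ℕ) (hq : 1 ≤ q) (x₀ x₁ : ℝ) (hx : x₀ < x₁)
    (w : Polynomial ℝ) (hw : w.degree ≤ (q : WithBot ℕ)) (α β : ℝ) :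
    ∃! p : Polynomial ℝ, p.degree ≤ ((q + 1 : ℕ) : WithBot ℕ) ∧
      (∀ ψ : Polynomial ℝ, ψ.degree ≤ ((q - 1 : ℕ) : WithBot ℕ) →
        ∫ x in x₀..x₁, (p.eval x - w.eval x) * ψ.eval x = 0) ∧
      p.eval x₀ = α ∧ p.eval x₁ = β := by
  obtain ⟨n, rfl⟩ := Nat.exists_eq_add_of_le' hq
  rw [Nat.add_sub_cancel]
  have hiff (p : Polynomial ℝ) (hp : p ∈ Polynomial.degreeLT ℝ (n + 1 + 2)) :
      Polynomial.momentEndpointMap x₀ x₁ (n + 1) ⟨p, hp⟩ =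
          ((Polynomial.degreeLT ℝ (n + 1)).subtype.dualMap (Polynomial.intervalPairing x₀ x₁ w),
            α, β) ↔
        (∀ ψ : Polynomial ℝ, ψ.degree ≤ (n : WithBot ℕ) →
          ∫ x in x₀..x₁, (p.eval x - w.eval x) * ψ.eval x = 0) ∧
        p.eval x₀ = α ∧ p.eval x₁ = β := by
    have hsub (ψ : Polynomial ℝ) : ∫ x in x₀..x₁, (p.eval x - w.eval x) * ψ.eval x =
        Polynomial.intervalPairing x₀ x₁ p ψ - Polynomial.intervalPairing x₀ x₁ w ψ := by
      rw [← LinearMap.sub_apply, ← map_sub, Polynomial.intervalPairing_apply]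
      simp only [Polynomial.eval_sub]
    simp only [hsub, Polynomial.degree_le_iff_mem_degreeLT_add_one, sub_eq_zero, Prod.ext_iff,
      LinearMap.ext_iff, Subtype.forall]
    rfl
  obtain ⟨⟨p, hp⟩, hpv, huniq⟩ := (Polynomial.momentEndpointMap_bijective hx (n + 1)).existsUnique
    ((Polynomial.degreeLT ℝ (n + 1)).subtype.dualMap (Polynomial.intervalPairing x₀ x₁ w), α, β)
  refine ⟨p, ⟨Polynomial.degree_le_iff_mem_degreeLT_add_one.mpr hp, (hiff p hp).mp hpv⟩,
    fun p' ⟨hdeg, h⟩ => ?_⟩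
  exact congrArg Subtype.val (huniq ⟨p', Polynomial.degree_le_iff_mem_degreeLT_add_one.mp hdeg⟩
    ((hiff p' _).mpr h))
end
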